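/- The ℂ-linear span of the functions x ↦ x^α · exp(−⟨A x, x⟩ + b·x) (α a multi-index, A positive-definite symmetric on ℝⁿ, b ∈ ℂⁿ) coincides with the ℂ-linear span of the functions x ↦ (∂^{δ(α)}/∂x^α) exp(−⟨A x, x⟩ + b·x) (α a multi-index, A positive-definite symmetric on ℝⁿ, b ∈ ℂⁿ). That is, every linear combination of building blocks of the first type is a linear combination of building blocks of the second type, and conversely. -/

import Mathlib

open MeasureTheory Real
open scoped RealInnerProductSpace

noncomputable section

/-- The Fourier transform of `f : ℝⁿ → ℂ`:
`f̂ ξ = ∫ x, f x · exp (−2πi x·ξ)`. -/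
def FT {n : ℕ} (f : EuclideanSpace ℝ (Fin n) → ℂ) (ξ : EuclideanSpace ℝ (Fin n)) : ℂ :=
  ∫ x : EuclideanSpace ℝ (Fin n),
    f x * Complex.exp (-2 * (Real.pi : ℂ) * Complex.I * (⟪x, ξ⟫ : ℂ))

/-- `A : ℝⁿ → ℝⁿ` linear is symmetric and positive-definite. -/
def IsPosDefSymm {n : ℕ}
    (A : EuclideanSpace ℝ (Fin n) →ₗ[ℝ] EuclideanSpace ℝ (Fin n)) : Prop :=
  (∀ x y, ⟪A x, y⟫ = ⟪x, A y⟫) ∧ (∀ x, x ≠ 0 → 0 < ⟪A x, x⟫)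

/-- The building block `x ↦ x^α · exp (−⟨A x, x⟩ + b·x)`. -/
def buildingBlock {n : ℕ} (α : Fin n → ℕ)
    (A : EuclideanSpace ℝ (Fin n) →ₗ[ℝ] EuclideanSpace ℝ (Fin n)) (b : Fin n → ℂ) :
    EuclideanSpace ℝ (Fin n) → ℂ :=
  fun x => (∏ j, (x j : ℂ) ^ α j) *
    Complex.exp (-(((⟪A x, x⟫ : ℝ)) : ℂ) + ∑ j, b j * (x j : ℂ))

/-- A function `f : ℝⁿ → ℂ` is nice if it is a complex linear combination of
building blocks `x ↦ x^α · exp (−⟨A x, x⟩ + b·x)` with `A` positive-definite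
symmetric. -/
def IsNice {n : ℕ} (f : EuclideanSpace ℝ (Fin n) → ℂ) : Prop :=
  f ∈ Submodule.span ℂ {g : EuclideanSpace ℝ (Fin n) → ℂ |
    ∃ α A b, IsPosDefSymm A ∧ g = buildingBlock α A b}

/-- The partial derivative in the `j`-th coordinate direction. -/
def pderivCoord {n : ℕ} (j : Fin n) (f : EuclideanSpace ℝ (Fin n) → ℂ) :
    EuclideanSpace ℝ (Fin n) → ℂ :=
  fun x => fderiv ℝ f x (EuclideanSpace.single j 1)

/-- The mixed partial derivative `∂^{δ(α)}/∂x^α`, with `α j` derivatives in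
the `j`-th coordinate direction. -/
def mixedDeriv {n : ℕ} (α : Fin n → ℕ) (f : EuclideanSpace ℝ (Fin n) → ℂ) :
    EuclideanSpace ℝ (Fin n) → ℂ :=
  (List.finRange n).foldr (fun j g => (pderivCoord j)^[α j] g) f


/-- The inverse Fourier transform `φ̌ x = ∫ ξ, φ ξ · exp (2πi ξ·x)`. -/
def invFT {n : ℕ} (φ : EuclideanSpace ℝ (Fin n) → ℂ) (x : EuclideanSpace ℝ (Fin n)) : ℂ :=
  ∫ ξ : EuclideanSpace ℝ (Fin n),
    φ ξ * Complex.exp (2 * (Real.pi : ℂ) * Complex.I * (⟪ξ, x⟫ : ℂ))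

end

noncomputable section

open MvPolynomial in
/-- The linear form `bⱼ - 2 ∑ₖ aⱼₖ xₖ`, the logarithmic derivative of
`exp (-⟨a x, x⟩ + b·x)` in the `j`-th direction for a symmetric matrix `a`. -/
def gaussianLogDeriv {n : ℕ} (a : Fin n → Fin n → ℂ) (b : Fin n → ℂ) (j : Fin n) :
    MvPolynomial (Fin n) ℂ :=
  C (b j) - 2 * ∑ k, C (a j k) * X k

/-- The `j`-th partial derivative conjugated by the Gaussian, as an operator on polynomials. -/
def twistedDeriv {n : ℕ} (a : Fin n → Fin n → ℂ) (b : Fin n → ℂ) (j : Fin n)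
    (p : MvPolynomial (Fin n) ℂ) : MvPolynomial (Fin n) ℂ :=
  MvPolynomial.pderiv j p + gaussianLogDeriv a b j * p

/-- The iterate of `twistedDeriv` over the directions in `l`, `α j` times in direction `j`. -/
def twistedMixedDeriv {n : ℕ} (a : Fin n → Fin n → ℂ) (b : Fin n → ℂ) (l : List (Fin n))
    (α : Fin n → ℕ) (p : MvPolynomial (Fin n) ℂ) : MvPolynomial (Fin n) ℂ :=
  l.foldr (fun j g => (twistedDeriv a b j)^[α j] g) p

open MvPolynomial in
lemma pderiv_gaussianLogDeriv {n : ℕ} (a : Fin n → Fin n → ℂ) (b : Fin n → ℂ) (i j : Fin n) :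
    pderiv i (gaussianLogDeriv a b j) = C (-2 * a j i) := by
  have h2 : (2 : MvPolynomial (Fin n) ℂ) = C 2 := (map_ofNat C 2).symm
  simp [gaussianLogDeriv, Derivation.leibniz, pderiv_X, h2, Pi.single_apply]

lemma twistedDeriv_gaussianLogDeriv_mul {n : ℕ} (a : Fin n → Fin n → ℂ) (b : Fin n → ℂ) (i k : Fin n)
    (p : MvPolynomial (Fin n) ℂ) :
    twistedDeriv a b i (gaussianLogDeriv a b k * p) =
      gaussianLogDeriv a b k * twistedDeriv a b i p + MvPolynomial.C (-2 * a k i) * p := by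
  simp only [twistedDeriv, Derivation.leibniz, pderiv_gaussianLogDeriv, smul_eq_mul]
  ring

lemma pderiv_pderiv_comm {n : ℕ} (i j : Fin n) (p : MvPolynomial (Fin n) ℂ) :
    MvPolynomial.pderiv i (MvPolynomial.pderiv j p) =
      MvPolynomial.pderiv j (MvPolynomial.pderiv i p) := by
  have h : ⁅(MvPolynomial.pderiv i : Derivation ℂ (MvPolynomial (Fin n) ℂ) _),
      (MvPolynomial.pderiv j : Derivation ℂ (MvPolynomial (Fin n) ℂ) _)⁆ = 0 := by
    ext k
    simp [Derivation.commutator_apply, MvPolynomial.pderiv_X, Pi.single_apply, apply_ite]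
  have := congrArg (fun D => D p) h
  simpa [Derivation.commutator_apply, sub_eq_zero] using this

lemma twistedDeriv_commute {n : ℕ} {a : Fin n → Fin n → ℂ} (ha : ∀ i j, a i j = a j i)
    (b : Fin n → ℂ) (i j : Fin n) :
    Function.Commute (twistedDeriv a b i) (twistedDeriv a b j) := by
  intro p
  simp only [twistedDeriv, Derivation.leibniz, pderiv_gaussianLogDeriv, smul_eq_mul, map_add,
    pderiv_pderiv_comm i j, ha i j]
  ring

lemma twistedMixedDeriv_add_single_of_notMem {n : ℕ} (a : Fin n → Fin n → ℂ) (b : Fin n → ℂ)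
    {l : List (Fin n)} {j : Fin n} (hj : j ∉ l) (α : Fin n → ℕ) (p : MvPolynomial (Fin n) ℂ) :
    twistedMixedDeriv a b l (α + Pi.single j 1) p = twistedMixedDeriv a b l α p := by
  refine List.foldr_ext _ _ _ fun i hi g => ?_
  have : i ≠ j := fun h => hj (h ▸ hi)
  simp [this]

lemma twistedDeriv_twistedMixedDeriv {n : ℕ} {a : Fin n → Fin n → ℂ}
    (ha : ∀ i j, a i j = a j i) (b : Fin n → ℂ) {l : List (Fin n)} (hl : l.Nodup) {j : Fin n}
    (hj : j ∈ l) (α : Fin n → ℕ) (p : MvPolynomial (Fin n) ℂ) :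
    twistedDeriv a b j (twistedMixedDeriv a b l α p) =
      twistedMixedDeriv a b l (α + Pi.single j 1) p := by
  induction l with
  | nil => simp at hj
  | cons i l ih =>
    obtain ⟨hi, hl⟩ := List.nodup_cons.1 hl
    change twistedDeriv a b j ((twistedDeriv a b i)^[α i] (twistedMixedDeriv a b l α p)) =
      (twistedDeriv a b i)^[(α + Pi.single j 1 : Fin n → ℕ) i]
        (twistedMixedDeriv a b l (α + Pi.single j 1) p)
    by_cases hij : i = j
    · subst hij
      rw [twistedMixedDeriv_add_single_of_notMem a b hi]
      simp [← Function.iterate_succ_apply' (twistedDeriv a b i)]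
    · rw [((twistedDeriv_commute ha b j i).iterate_right (α i)).eq,
        ih hl ((List.mem_cons.1 hj).resolve_left fun h => hij h.symm)]
      simp [hij]

/-- The polynomials obtained from `1` by twisted mixed derivatives span all polynomials as soon
as the matrix `a` is symmetric and invertible. -/
lemma span_twistedMixedDeriv_eq_top {n : ℕ} {a : Fin n → Fin n → ℂ} (ha : ∀ i j, a i j = a j i)
    (hinv : ∀ k, ∃ v : Fin n → ℂ, ∀ m, ∑ j, v j * a j m = if m = k then 1 else 0)
    (b : Fin n → ℂ) :
    Submodule.span ℂ (Set.range fun α => twistedMixedDeriv a b (List.finRange n) α 1) = ⊤ := by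
  set W := Submodule.span ℂ
    (Set.range fun α => twistedMixedDeriv a b (List.finRange n) α 1)
  have hone : (1 : MvPolynomial (Fin n) ℂ) ∈ W := by
    refine Submodule.subset_span ⟨0, ?_⟩
    simp only [twistedMixedDeriv, Pi.zero_apply, Function.iterate_zero, id]
    exact List.foldr_fixed _
  have hgen (j : Fin n) (α : Fin n → ℕ) :
      twistedDeriv a b j (twistedMixedDeriv a b (List.finRange n) α 1) ∈ W :=
    Submodule.subset_span ⟨α + Pi.single j 1, (twistedDeriv_twistedMixedDeriv ha b
      (List.nodup_finRange n) (List.mem_finRange j) α 1).symm⟩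
  have hD (j : Fin n) {p} (hp : p ∈ W) : twistedDeriv a b j p ∈ W := by
    induction hp using Submodule.span_induction with
    | mem x hx => obtain ⟨α, rfl⟩ := hx; exact hgen j α
    | zero => simp [twistedDeriv]
    | add x y _ _ hx hy =>
      convert W.add_mem hx hy using 1
      simp only [twistedDeriv, map_add]; ring
    | smul c x _ hx =>
      convert W.smul_mem c hx using 1
      simp [twistedDeriv, smul_add]
  have hL_iter (k i : Fin n) (m : ℕ) {p} (hp : p ∈ W ∧ gaussianLogDeriv a b k * p ∈ W) :
      (twistedDeriv a b i)^[m] p ∈ W ∧ gaussianLogDeriv a b k * (twistedDeriv a b i)^[m] p ∈ W := by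
    induction m with
    | zero => exact hp
    | succ m ih =>
      rw [Function.iterate_succ_apply']
      refine ⟨hD i ih.1, ?_⟩
      rw [eq_sub_of_add_eq (twistedDeriv_gaussianLogDeriv_mul a b i k _).symm, ← MvPolynomial.smul_eq_C_mul]
      exact W.sub_mem (hD i ih.2) (W.smul_mem _ ih.1)
  have hL_mixed (k : Fin n) (α : Fin n → ℕ) (l : List (Fin n)) :
      twistedMixedDeriv a b l α 1 ∈ W ∧ gaussianLogDeriv a b k * twistedMixedDeriv a b l α 1 ∈ W := by
    induction l with
    | nil =>
      refine ⟨hone, ?_⟩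
      simpa [twistedDeriv, twistedMixedDeriv] using hD k hone
    | cons i l ih => exact hL_iter k i (α i) ih
  have hL (k : Fin n) {p} (hp : p ∈ W) : gaussianLogDeriv a b k * p ∈ W := by
    induction hp using Submodule.span_induction with
    | mem x hx => obtain ⟨α, rfl⟩ := hx; exact (hL_mixed k α _).2
    | zero => simp
    | add x y _ _ hx hy => rw [mul_add]; exact W.add_mem hx hy
    | smul c x _ hx => rw [mul_smul_comm]; exact W.smul_mem c hx
  have hX (k : Fin n) {p} (hp : p ∈ W) : p * MvPolynomial.X k ∈ W := by
    obtain ⟨v, hv⟩ := hinv k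
    have hsum : ∑ j, MvPolynomial.C (v j) * gaussianLogDeriv a b j =
        MvPolynomial.C (∑ j, v j * b j) - 2 * MvPolynomial.X k := by
      have hX_eq : (MvPolynomial.X k : MvPolynomial (Fin n) ℂ) =
          ∑ j, ∑ m, MvPolynomial.C (v j) * (MvPolynomial.C (a j m) * MvPolynomial.X m) := by
        rw [Finset.sum_comm]
        simp_rw [← mul_assoc, ← Finset.sum_mul, ← map_mul, ← map_sum, hv]
        simp [apply_ite, ite_mul]
      rw [hX_eq]
      simp only [gaussianLogDeriv, mul_sub, Finset.sum_sub_distrib, map_sum, map_mul, Finset.mul_sum,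
        mul_left_comm]
    have key : p * MvPolynomial.X k = (1 / 2 : ℂ) • ((∑ j, v j * b j) • p -
        ∑ j, v j • (gaussianLogDeriv a b j * p)) := by
      simp_rw [MvPolynomial.smul_eq_C_mul, ← mul_assoc, ← Finset.sum_mul]
      rw [hsum]
      have h2 : MvPolynomial.C (1 / 2 : ℂ) * 2 = (1 : MvPolynomial (Fin n) ℂ) := by
        rw [← map_ofNat MvPolynomial.C 2, ← map_mul]; norm_num
      linear_combination (-(p * MvPolynomial.X k)) * h2
    rw [key]
    exact W.smul_mem _ (W.sub_mem (W.smul_mem _ hp)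
      (W.sum_mem fun j _ => W.smul_mem _ (hL j hp)))
  refine (Submodule.eq_top_iff').2 fun p => ?_
  induction p using MvPolynomial.induction_on with
  | C c => simpa [MvPolynomial.smul_eq_C_mul] using W.smul_mem c hone
  | add p q hp hq => exact W.add_mem hp hq
  | mul_X p i hp => exact hX i hp

/-- The function `x ↦ exp (-⟨A x, x⟩ + b·x)`. -/
def gaussian {n : ℕ} (A : EuclideanSpace ℝ (Fin n) →ₗ[ℝ] EuclideanSpace ℝ (Fin n))
    (b : Fin n → ℂ) (x : EuclideanSpace ℝ (Fin n)) : ℂ :=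
  Complex.exp (-((⟪A x, x⟫ : ℝ) : ℂ) + ∑ j, b j * (x j : ℂ))

/-- Multiplication of the Gaussian by a polynomial function. -/
def mulGaussian {n : ℕ} (A : EuclideanSpace ℝ (Fin n) →ₗ[ℝ] EuclideanSpace ℝ (Fin n))
    (b : Fin n → ℂ) : MvPolynomial (Fin n) ℂ →ₗ[ℂ] (EuclideanSpace ℝ (Fin n) → ℂ) where
  toFun p x := MvPolynomial.eval (fun j => (x j : ℂ)) p * gaussian A b x
  map_add' p q := by ext x; simp [add_mul]
  map_smul' c p := by ext x; simp [mul_assoc]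

/-- The matrix of `A` in the standard basis, with complex entries. -/
def coordMatrix {n : ℕ} (A : EuclideanSpace ℝ (Fin n) →ₗ[ℝ] EuclideanSpace ℝ (Fin n))
    (j k : Fin n) : ℂ :=
  ((A (EuclideanSpace.single k 1) j : ℝ) : ℂ)

lemma sum_mul_apply_single {n : ℕ} (A : EuclideanSpace ℝ (Fin n) →ₗ[ℝ] EuclideanSpace ℝ (Fin n))
    (x : EuclideanSpace ℝ (Fin n)) (j : Fin n) :
    ∑ k, A (EuclideanSpace.single k 1) j * x k = A x j := by
  have hx : x = ∑ k, x k • EuclideanSpace.single k (1 : ℝ) := by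
    ext i; simp [Pi.single_apply]
  conv_rhs => rw [hx]
  simp [mul_comm]

lemma IsPosDefSymm.coordMatrix_symm {n : ℕ}
    {A : EuclideanSpace ℝ (Fin n) →ₗ[ℝ] EuclideanSpace ℝ (Fin n)} (hA : IsPosDefSymm A)
    (i j : Fin n) : coordMatrix A i j = coordMatrix A j i := by
  have := hA.1 (EuclideanSpace.single j 1) (EuclideanSpace.single i 1)
  simp only [EuclideanSpace.inner_single_left, EuclideanSpace.inner_single_right] at this
  simpa [coordMatrix] using this

lemma IsPosDefSymm.exists_sum_mul_coordMatrix {n : ℕ}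
    {A : EuclideanSpace ℝ (Fin n) →ₗ[ℝ] EuclideanSpace ℝ (Fin n)} (hA : IsPosDefSymm A)
    (k : Fin n) :
    ∃ v : Fin n → ℂ, ∀ m, ∑ j, v j * coordMatrix A j m = if m = k then 1 else 0 := by
  have hinj : Function.Injective A := by
    refine (injective_iff_map_eq_zero A).2 fun x hx => ?_
    by_contra h
    simpa [hx] using hA.2 x h
  obtain ⟨v, hv⟩ := LinearMap.injective_iff_surjective.1 hinj (EuclideanSpace.single k 1)
  refine ⟨fun j => (v j : ℂ), fun m => ?_⟩
  have h := sum_mul_apply_single A v m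
  rw [hv] at h
  simp_rw [hA.coordMatrix_symm _ m, mul_comm, coordMatrix]
  rw [← Complex.ofReal_one, ← Complex.ofReal_zero, ← apply_ite]
  exact_mod_cast h.trans (by simp)

lemma hasFDerivAt_coord {n : ℕ} (j : Fin n) (x : EuclideanSpace ℝ (Fin n)) :
    HasFDerivAt (fun x : EuclideanSpace ℝ (Fin n) => (x j : ℂ))
      (Complex.ofRealCLM.comp (EuclideanSpace.proj j)) x :=
  (Complex.ofRealCLM.comp (EuclideanSpace.proj (𝕜 := ℝ) j)).hasFDerivAt

lemma differentiable_eval {n : ℕ} (p : MvPolynomial (Fin n) ℂ) :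
    Differentiable ℝ
      (fun x : EuclideanSpace ℝ (Fin n) => MvPolynomial.eval (fun j => (x j : ℂ)) p) := by
  induction p using MvPolynomial.induction_on with
  | C c => simp
  | add p q hp hq => simpa using hp.fun_add hq
  | mul_X p i hp => simpa using hp.fun_mul fun x => (hasFDerivAt_coord i x).differentiableAt

lemma pderivCoord_eval {n : ℕ} (p : MvPolynomial (Fin n) ℂ) (j : Fin n)
    (x : EuclideanSpace ℝ (Fin n)) :
    pderivCoord j (fun x => MvPolynomial.eval (fun j => (x j : ℂ)) p) x =
      MvPolynomial.eval (fun j => (x j : ℂ)) (MvPolynomial.pderiv j p) := by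
  unfold pderivCoord
  induction p using MvPolynomial.induction_on with
  | C c => simp
  | add p q hp hq =>
    simp only [map_add]
    rw [fderiv_fun_add (differentiable_eval p x) (differentiable_eval q x)]
    simp [hp, hq]
  | mul_X p i hp =>
    simp only [map_mul, MvPolynomial.eval_X]
    rw [fderiv_fun_mul (differentiable_eval p x) (hasFDerivAt_coord i x).differentiableAt,
      (hasFDerivAt_coord i x).fderiv]
    simp [hp, Derivation.leibniz, MvPolynomial.pderiv_X, Pi.single_apply, apply_ite, eq_comm]

lemma hasFDerivAt_gaussian {n : ℕ}
    (A : EuclideanSpace ℝ (Fin n) →ₗ[ℝ] EuclideanSpace ℝ (Fin n)) (b : Fin n → ℂ)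
    (x : EuclideanSpace ℝ (Fin n)) :
    HasFDerivAt (gaussian A b) (gaussian A b x •
      (-Complex.ofRealCLM.comp ((innerSL ℝ (A x)) + (innerSL ℝ x).comp A.toContinuousLinearMap) +
        ∑ j, b j • Complex.ofRealCLM.comp (EuclideanSpace.proj j))) x := by
  have hinner : HasFDerivAt (fun x => ⟪A x, x⟫)
      ((innerSL ℝ (A x)) + (innerSL ℝ x).comp A.toContinuousLinearMap) x := by
    refine ((A.toContinuousLinearMap.hasFDerivAt (x := x)).inner ℝ
      (hasFDerivAt_id x)).congr_fderiv ?_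
    ext v
    simp [real_inner_comm]
  exact (((Complex.ofRealCLM.hasFDerivAt.comp x hinner).neg).add
    (HasFDerivAt.fun_sum fun j _ => (hasFDerivAt_coord j x).const_mul (b j))).cexp

lemma IsPosDefSymm.pderivCoord_mulGaussian {n : ℕ}
    {A : EuclideanSpace ℝ (Fin n) →ₗ[ℝ] EuclideanSpace ℝ (Fin n)} (hA : IsPosDefSymm A)
    (b : Fin n → ℂ) (j : Fin n) (p : MvPolynomial (Fin n) ℂ) :
    pderivCoord j (mulGaussian A b p) =
      mulGaussian A b (twistedDeriv (coordMatrix A) b j p) := by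
  ext x
  have hp := pderivCoord_eval p j x
  unfold pderivCoord at hp ⊢
  change fderiv ℝ (fun x => MvPolynomial.eval (fun j => (x j : ℂ)) p * gaussian A b x) x _ =
    MvPolynomial.eval (fun j => (x j : ℂ)) (twistedDeriv (coordMatrix A) b j p) * gaussian A b x
  have hsymm : ⟪x, A (EuclideanSpace.single j 1)⟫ = A x j := by
    rw [← hA.1]; simp [EuclideanSpace.inner_single_right]
  have hAx : (A x j : ℂ) = ∑ k, coordMatrix A j k * (x k : ℂ) := by
    rw [← sum_mul_apply_single A x j]; simp [coordMatrix]
  rw [fderiv_fun_mul (differentiable_eval p x) (hasFDerivAt_gaussian A b x).differentiableAt,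
    (hasFDerivAt_gaussian A b x).fderiv]
  simp [hp, hsymm, twistedDeriv, gaussianLogDeriv, EuclideanSpace.inner_single_right, hAx,
    apply_ite Complex.ofReal]
  ring

lemma IsPosDefSymm.mixedDeriv_gaussian {n : ℕ}
    {A : EuclideanSpace ℝ (Fin n) →ₗ[ℝ] EuclideanSpace ℝ (Fin n)} (hA : IsPosDefSymm A)
    (b : Fin n → ℂ) (α : Fin n → ℕ) :
    mixedDeriv α (gaussian A b) =
      mulGaussian A b (twistedMixedDeriv (coordMatrix A) b (List.finRange n) α 1) := by
  have hbase : gaussian A b = mulGaussian A b 1 := by ext x; simp [mulGaussian]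
  have hiter (j : Fin n) (m : ℕ) (p : MvPolynomial (Fin n) ℂ) :
      (pderivCoord j)^[m] (mulGaussian A b p) =
        mulGaussian A b ((twistedDeriv (coordMatrix A) b j)^[m] p) :=
    ((Function.Semiconj.iterate_right (fun p => (hA.pderivCoord_mulGaussian b j p).symm) m)
      p).symm
  rw [hbase]
  unfold mixedDeriv twistedMixedDeriv
  induction List.finRange n with
  | nil => rfl
  | cons i l ih => simp only [List.foldr_cons, ih, hiter]

lemma mulGaussian_monomial {n : ℕ}
    (A : EuclideanSpace ℝ (Fin n) →ₗ[ℝ] EuclideanSpace ℝ (Fin n)) (b : Fin n → ℂ)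
    (α : Fin n →₀ ℕ) (c : ℂ) :
    mulGaussian A b (MvPolynomial.monomial α c) = c • buildingBlock α A b := by
  ext x
  simp [mulGaussian, buildingBlock, gaussian, MvPolynomial.eval_monomial, Finsupp.prod_fintype,
    mul_assoc]

end

/-- The span of the building blocks `x ↦ x^α exp (−⟨A x, x⟩ + b·x)` equals the
span of the building blocks `x ↦ ∂^{δ(α)}/∂x^α exp (−⟨A x, x⟩ + b·x)`. -/
theorem span_buildingBlocks_eq_span_derivBlocks (n : ℕ) :
    Submodule.span ℂ {g : EuclideanSpace ℝ (Fin n) → ℂ |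
        ∃ α A b, IsPosDefSymm A ∧ g = buildingBlock α A b}
      = Submodule.span ℂ {g : EuclideanSpace ℝ (Fin n) → ℂ |
          ∃ (α : Fin n → ℕ)
            (A : EuclideanSpace ℝ (Fin n) →ₗ[ℝ] EuclideanSpace ℝ (Fin n))
            (b : Fin n → ℂ), IsPosDefSymm A ∧
            g = mixedDeriv α (fun x =>
              Complex.exp (-((⟪A x, x⟫ : ℝ) : ℂ) + ∑ j, b j * (x j : ℂ)))} := by
  refine le_antisymm (Submodule.span_le.2 ?_) (Submodule.span_le.2 ?_)
  · rintro _ ⟨α, A, b, hA, rfl⟩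
    have htop := span_twistedMixedDeriv_eq_top hA.coordMatrix_symm
      hA.exists_sum_mul_coordMatrix b
    have hmem : mulGaussian A b (MvPolynomial.monomial (Finsupp.equivFunOnFinite.symm α) 1) ∈
        (Submodule.span ℂ (Set.range fun β =>
          twistedMixedDeriv (coordMatrix A) b (List.finRange n) β 1)).map (mulGaussian A b) :=
      Submodule.mem_map_of_mem (htop ▸ Submodule.mem_top)
    rw [mulGaussian_monomial, one_smul, Submodule.map_span] at hmem
    refine Submodule.span_mono ?_ hmem
    rintro _ ⟨_, ⟨β, rfl⟩, rfl⟩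
    exact ⟨β, A, b, hA, (hA.mixedDeriv_gaussian b β).symm⟩
  · rintro _ ⟨α, A, b, hA, rfl⟩
    change mixedDeriv α (gaussian A b) ∈ _
    rw [hA.mixedDeriv_gaussian, MvPolynomial.as_sum
      (twistedMixedDeriv (coordMatrix A) b (List.finRange n) α 1), map_sum]
    refine Submodule.sum_mem _ fun β _ => ?_
    rw [mulGaussian_monomial]
    exact Submodule.smul_mem _ _ (Submodule.subset_span ⟨β, A, b, hA, rfl⟩)
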